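/- Consider scalings K_n, P_n, α_n such that α_n(1 − q(θ_n)) = (log n + γ_n)/n for all n, for some real sequence γ_n with lim_{n→∞} γ_n = −∞. If either (a) limsup_{n→∞} α_n log n < ∞, or (b) limsup_{n→∞} α_n log n = ∞ and limsup_{n→∞} α_n < 1, then lim_{n→∞} P_n(θ_n, α_n) = 0, i.e., with probability tending to one the random graph K∩G(n; θ_n, α_n) contains at least one isolated node. -/

import Mathlib

open Filter Finset

noncomputable section

/-- Key rings: `K`-element subsets of a pool `{1,…,P}` of keys. -/
abbrev KeyRing (P K : ℕ) : Type := {S : Finset (Fin P) // S.card = K}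

/-- Unordered node pairs, represented as ordered pairs `(i,j)` with `i < j`. -/
abbrev Pairs (n : ℕ) : Type := {e : Fin n × Fin n // e.1 < e.2}

/-- The number `C(P,K)` of possible key rings. -/
def numKR (P K : ℕ) : ℝ := (P.choose K : ℝ)

/-- Probability weight of a configuration `(κ, b)` under the product of the uniform
distribution on key rings (i.i.d. over the `n` nodes) and i.i.d. Bernoulli(α)
on/off link variables (one per unordered pair of nodes). -/
def wt (n P K : ℕ) (α : ℝ) (κ : Fin n → KeyRing P K) (b : Pairs n → Bool) : ℝ :=
  (numKR P K)⁻¹ ^ n * ∏ e : Pairs n, (if b e then α else 1 - α)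

/-- The on/off state of the channel between nodes `i` and `j`. -/
def link {n : ℕ} (b : Pairs n → Bool) (i j : Fin n) : Bool :=
  if h : i < j then b ⟨(i, j), h⟩
  else if h' : j < i then b ⟨(j, i), h'⟩
  else false

/-- Adjacency in the intersection graph `K ∩ G(n; θ, α)`:  the key rings of `i` and `j`
intersect and the channel between them is on. -/
abbrev Adj {n P K : ℕ} (κ : Fin n → KeyRing P K) (b : Pairs n → Bool) (i j : Fin n) : Prop :=
  i ≠ j ∧ ((κ i).1 ∩ (κ j).1).Nonempty ∧ link b i j = true

/-- Node `i` is isolated: it is adjacent to no other node. -/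
abbrev Isolated {n P K : ℕ} (κ : Fin n → KeyRing P K) (b : Pairs n → Bool) (i : Fin n) : Prop :=
  ∀ j, ¬ Adj κ b i j

/-- `P_n(θ,α)`: probability that `K ∩ G(n; θ, α)` contains no isolated nodes. -/
def probNoIsolated (n P K : ℕ) (α : ℝ) : ℝ :=
  ∑ κ : Fin n → KeyRing P K, ∑ b : Pairs n → Bool,
    wt n P K α κ b * (if ∀ i, ¬ Isolated κ b i then 1 else 0)

/-- Number of isolated nodes in the configuration `(κ, b)`. -/
def numIsolated {n P K : ℕ} (κ : Fin n → KeyRing P K) (b : Pairs n → Bool) : ℕ :=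
  (Finset.univ.filter fun i => Isolated κ b i).card

/-- `E[I_n(θ,α)]`: expected number of isolated nodes in `K ∩ G(n; θ, α)`. -/
def expIsolated (n P K : ℕ) (α : ℝ) : ℝ :=
  ∑ κ : Fin n → KeyRing P K, ∑ b : Pairs n → Bool,
    wt n P K α κ b * (numIsolated κ b : ℝ)

/-- `q(θ) = C(P−K,K)/C(P,K)` if `2K ≤ P`, and `0` otherwise. -/
def q (K P : ℕ) : ℝ :=
  if 2 * K ≤ P then ((P - K).choose K : ℝ) / (P.choose K : ℝ) else 0

/-- `v(θ;r) = C(P−r,K)/C(P,K)` if `r ≤ P−K`, and `0` otherwise. -/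
def v (K P r : ℕ) : ℝ :=
  if r ≤ P - K then ((P - r).choose K : ℝ) / (P.choose K : ℝ) else 0

end

section Aux

/-- Edges from `i` to a node satisfying `Q`. -/
def touchSet {n : ℕ} (i : Fin n) (Q : Fin n → Prop) [DecidablePred Q] : Finset (Pairs n) :=
  Finset.univ.filter fun e => (e.1.1 = i ∧ Q e.1.2) ∨ (e.1.2 = i ∧ Q e.1.1)

lemma touchSet_card {n : ℕ} (i : Fin n) (Q : Fin n → Prop) [DecidablePred Q] (hQ : ¬ Q i) :
    (touchSet i Q).card = (Finset.univ.filter Q).card := by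
  symm
  refine Finset.card_bij (fun k hk => if h : i < k then ⟨(i, k), h⟩ else ⟨(k, i), ?_⟩) ?_ ?_ ?_
  · have hk' : Q k := by simpa using hk
    have : k ≠ i := fun h => hQ (h ▸ hk')
    exact lt_of_le_of_ne (not_lt.1 h) this
  · intro k hk
    have hk' : Q k := by simpa using hk
    unfold touchSet
    split_ifs with h <;> simp [hk']
  · intro k hk l hl h
    split_ifs at h with h1 h2 h2 <;> simp at h
    · exact h
    · exact absurd h1 (by rw [h.2]; simp)
    · exact absurd h2 (by rw [← h.2]; simp)
    · exact h
  · rintro ⟨⟨a, b⟩, hab⟩ he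
    simp only [touchSet, Finset.mem_filter, Finset.mem_univ, true_and] at he
    simp only at hab
    rcases he with ⟨h1, h2⟩ | ⟨h1, h2⟩
    · subst h1
      exact ⟨b, by simpa using h2, by simp [hab]⟩
    · subst h1
      exact ⟨a, by simpa using h2, by simp [not_lt.2 hab.le]⟩

lemma link_false_iff {n : ℕ} (b : Pairs n → Bool) (i : Fin n) (Q : Fin n → Prop)
    [DecidablePred Q] :
    (∀ e ∈ touchSet i Q, b e = false) ↔ ∀ k, k ≠ i → Q k → link b i k = false := by
  constructor
  · intro h k hk hq
    unfold link
    split_ifs with h1 h2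
    · exact h _ (by simp [touchSet, hq])
    · exact h _ (by simp [touchSet, hq])
    · rfl
  · rintro h ⟨⟨x, y⟩, hxy⟩ he
    simp only [touchSet, Finset.mem_filter, Finset.mem_univ, true_and] at he
    simp only at hxy
    rcases he with ⟨h1, h2⟩ | ⟨h1, h2⟩
    · subst h1
      simpa [link, hxy] using h y hxy.ne' h2
    · subst h1
      simpa [link, hxy, not_lt.2 hxy.le] using h x hxy.ne h2

lemma sum_off {n : ℕ} (α : ℝ) (T : Finset (Pairs n)) :
    ∑ b : Pairs n → Bool, (∏ e : Pairs n, (if b e then α else 1 - α)) *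
      (if ∀ e ∈ T, b e = false then (1:ℝ) else 0) = (1 - α) ^ T.card := by
  have h1 : ∀ b : Pairs n → Bool, (∏ e : Pairs n, (if b e then α else 1 - α)) *
      (if ∀ e ∈ T, b e = false then (1:ℝ) else 0) =
      ∏ e : Pairs n, ((if b e then α else 1 - α) * (if e ∈ T ∧ b e = true then 0 else 1)) := by
    intro b
    rw [Finset.prod_mul_distrib]
    congr 1
    split_ifs with h
    · symm
      apply Finset.prod_eq_one
      intro e _
      rw [if_neg]
      rintro ⟨h1, h2⟩
      simp [h e h1] at h2
    · push Not at h
      obtain ⟨e, he, hb⟩ := h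
      symm
      apply Finset.prod_eq_zero (Finset.mem_univ e)
      simp [he, hb]
  simp_rw [h1]
  rw [← Fintype.prod_sum (fun (e : Pairs n) (β : Bool) =>
    ((if β then α else 1 - α) * (if e ∈ T ∧ β = true then (0:ℝ) else 1)))]
  have h2 : ∀ e : Pairs n, (∑ β : Bool, ((if β then α else 1 - α) *
      (if e ∈ T ∧ β = true then (0:ℝ) else 1))) = if e ∈ T then 1 - α else 1 := by
    intro e
    by_cases he : e ∈ T <;> simp [he]
  simp_rw [h2]
  rw [Finset.prod_ite]
  simp

lemma pow_card_filter {n : ℕ} (c : ℝ) (Q : Fin n → Prop) [DecidablePred Q] :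
    c ^ (Finset.univ.filter Q).card = ∏ k, if Q k then c else 1 := by
  rw [Finset.prod_ite]
  simp

/-- split off one coordinate -/
lemma sum_split1 {n : ℕ} {X : Type*} [Fintype X] [DecidableEq X] (i : Fin n) (g : X → X → ℝ) :
    ∑ κ : Fin n → X, ∏ k, (if k ≠ i then g (κ i) (κ k) else 1) =
      ∑ a : X, (∑ x, g a x) ^ (n - 1) := by
  have h1 : ∀ κ : Fin n → X, ∏ k, (if k ≠ i then g (κ i) (κ k) else 1) =
      ∑ a : X, ∏ k, (if k ≠ i then g a (κ k) else if κ k = a then 1 else 0) := by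
    intro κ
    rw [Finset.sum_eq_single (κ i)]
    · apply Finset.prod_congr rfl
      intro k _
      by_cases h : k = i <;> simp [h]
    · intro a _ ha
      apply Finset.prod_eq_zero (Finset.mem_univ i)
      simp [ha.symm]
    · simp
  simp_rw [h1]
  rw [Finset.sum_comm]
  apply Finset.sum_congr rfl
  intro a _
  rw [← Fintype.prod_sum (fun (k : Fin n) (x : X) =>
    (if k ≠ i then g a x else if x = a then 1 else 0))]
  have h2 : ∀ k, ∑ x, (if k ≠ i then g a x else if x = a then 1 else 0) =
      if k ≠ i then ∑ x, g a x else 1 := by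
    intro k
    by_cases h : k = i <;> simp [h]
  simp_rw [h2]
  rw [Finset.prod_ite]
  simp [Finset.filter_ne']

lemma sum_split2 {n : ℕ} {X : Type*} [Fintype X] [DecidableEq X] (i j : Fin n) (hij : i ≠ j)
    (g : X → X → X → ℝ) :
    ∑ κ : Fin n → X, ∏ k, (if k ≠ i ∧ k ≠ j then g (κ i) (κ j) (κ k) else 1) =
      ∑ a : X, ∑ c : X, (∑ x, g a c x) ^ (n - 2) := by
  have h1 : ∀ κ : Fin n → X, ∏ k, (if k ≠ i ∧ k ≠ j then g (κ i) (κ j) (κ k) else 1) =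
      ∑ ac : X × X, ∏ k, (if k ≠ i ∧ k ≠ j then g ac.1 ac.2 (κ k) else
        if κ k = (if k = i then ac.1 else ac.2) then 1 else 0) := by
    intro κ
    rw [Finset.sum_eq_single (κ i, κ j)]
    · apply Finset.prod_congr rfl
      intro k _
      by_cases h : k = i
      · simp [h]
      · by_cases h' : k = j <;> simp [h, h', hij.symm]
    · rintro ⟨a, c⟩ _ ha
      by_cases h : κ i = a
      · have h' : κ j ≠ c := fun h' => ha (by rw [h, h'])
        apply Finset.prod_eq_zero (Finset.mem_univ j)
        simp [h', hij.symm]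
      · apply Finset.prod_eq_zero (Finset.mem_univ i)
        simp [h]
    · simp
  simp_rw [h1]
  rw [Finset.sum_comm, Fintype.sum_prod_type]
  apply Finset.sum_congr rfl
  intro a _
  apply Finset.sum_congr rfl
  intro c _
  rw [← Fintype.prod_sum (fun (k : Fin n) (x : X) =>
    (if k ≠ i ∧ k ≠ j then g a c x else if x = (if k = i then a else c) then 1 else 0))]
  have h2 : ∀ k, ∑ x, (if k ≠ i ∧ k ≠ j then g a c x else
      if x = (if k = i then a else c) then 1 else 0) =
      if k ≠ i ∧ k ≠ j then ∑ x, g a c x else 1 := by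
    intro k
    by_cases h : k ≠ i ∧ k ≠ j
    · simp [h]
    · simp only [if_neg h]
      simp
  simp_rw [h2]
  rw [Finset.prod_ite]
  have h3 : (Finset.univ.filter fun k : Fin n => k ≠ i ∧ k ≠ j) = Finset.univ \ {i, j} := by
    ext k; simp
  rw [h3]
  simp [Finset.card_univ_sdiff, Finset.card_pair hij]

lemma card_disj {P K : ℕ} (S : Finset (Fin P)) :
    (Finset.univ.filter fun x : KeyRing P K => ¬ (S ∩ x.1).Nonempty).card
      = (P - S.card).choose K := by
  have h : (Finset.univ.filter fun x : KeyRing P K => ¬ (S ∩ x.1).Nonempty).card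
      = (Finset.powersetCard K Sᶜ).card := by
    refine Finset.card_bij (fun x _ => x.1) ?_ ?_ ?_
    · intro x hx
      simp only [Finset.mem_filter, Finset.mem_univ, true_and, Finset.not_nonempty_iff_eq_empty] at hx
      rw [Finset.mem_powersetCard]
      refine ⟨?_, x.2⟩
      intro y hy
      rw [Finset.mem_compl]
      intro hS
      have : y ∈ S ∩ x.1 := Finset.mem_inter.2 ⟨hS, hy⟩
      rw [hx] at this
      simp at this
    · intro x _ y _ h
      exact Subtype.ext h
    · intro T hT
      rw [Finset.mem_powersetCard] at hT
      refine ⟨⟨T, hT.2⟩, ?_, rfl⟩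
      simp only [Finset.mem_filter, Finset.mem_univ, true_and, Finset.not_nonempty_iff_eq_empty]
      ext y
      simp only [Finset.mem_inter, Finset.notMem_empty, iff_false, not_and]
      intro h1 h2
      exact (Finset.mem_compl.1 (hT.1 h2)) h1
  rw [h, Finset.card_powersetCard, Finset.card_compl, Fintype.card_fin]

lemma card_KR (P K : ℕ) : Fintype.card (KeyRing P K) = P.choose K := by
  simp

lemma q_eq (K P : ℕ) : q K P = ((P - K).choose K : ℝ) / (P.choose K : ℝ) := by
  unfold q
  split_ifs with h
  · rfl
  · rw [Nat.choose_eq_zero_of_lt (by omega)]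
    simp

lemma choose_logconcave (P K : ℕ) :
    (P - 2 * K).choose K * P.choose K ≤ (P - K).choose K ^ 2 := by
  have h : (P - 2 * K).descFactorial K * P.descFactorial K ≤ (P - K).descFactorial K ^ 2 := by
    simp only [Nat.descFactorial_eq_prod_range]
    rw [← Finset.prod_mul_distrib, ← Finset.prod_pow]
    apply Finset.prod_le_prod'
    intro i _
    by_cases h : 2 * K + i ≤ P
    · obtain ⟨d, rfl⟩ := Nat.exists_eq_add_of_le h
      have e1 : 2 * K + i + d - 2 * K - i = d := by omega
      have e2 : 2 * K + i + d - i = 2 * K + d := by omega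
      have e3 : 2 * K + i + d - K - i = K + d := by omega
      rw [e1, e2, e3]
      nlinarith [Nat.zero_le (K * K)]
    · have e1 : P - 2 * K - i = 0 := by omega
      rw [e1]; simp
  simp only [Nat.descFactorial_eq_factorial_mul_choose] at h
  have hf : 0 < K.factorial ^ 2 := by positivity
  refine Nat.le_of_mul_le_mul_left ?_ hf
  nlinarith [h]

lemma chebyshev_aux {Ω : Type*} [Fintype Ω] (w : Ω → ℝ) (hw : ∀ ω, 0 ≤ w ω) (hw1 : ∑ ω, w ω = 1)
    (n : ℕ) (hn : 0 < n) (A : Fin n → Ω → Prop) [∀ i ω, Decidable (A i ω)]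
    (r B : ℝ) (hr : 0 < r) (hB : 0 ≤ B)
    (h1 : ∀ i, ∑ ω, w ω * (if A i ω then 1 else 0) = r)
    (h2 : ∀ i j, i ≠ j → ∑ ω, w ω * (if A i ω ∧ A j ω then 1 else 0) ≤ B) :
    ∑ ω, w ω * (if ∀ i, ¬ A i ω then 1 else 0) ≤ 1 / (n * r) + B / r ^ 2 - 1 := by
  set I : Ω → ℝ := fun ω => ∑ i, (if A i ω then (1:ℝ) else 0) with hI
  set m : ℝ := n * r with hm
  have hnpos : (0:ℝ) < n := by exact_mod_cast hn
  have hmpos : 0 < m := by positivity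
  have hEI : ∑ ω, w ω * I ω = m := by
    simp only [hI, Finset.mul_sum]
    rw [Finset.sum_comm]
    simp only [h1, Finset.sum_const, Finset.card_univ, Fintype.card_fin, nsmul_eq_mul, hm]
  have hEI2 : ∑ ω, w ω * (I ω) ^ 2 ≤ m + n ^ 2 * B := by
    have e : ∀ ω, w ω * (I ω) ^ 2 =
        ∑ i, ∑ j, w ω * (if A i ω ∧ A j ω then (1:ℝ) else 0) := by
      intro ω
      rw [sq, hI]
      simp only
      rw [Finset.sum_mul_sum, Finset.mul_sum]
      apply Finset.sum_congr rfl
      intro i _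
      rw [Finset.mul_sum]
      apply Finset.sum_congr rfl
      intro j _
      by_cases a : A i ω <;> by_cases b : A j ω <;> simp [a, b]
    simp_rw [e]
    rw [Finset.sum_comm]
    have : ∀ i ∈ (Finset.univ : Finset (Fin n)), ∑ ω, ∑ j, w ω * (if A i ω ∧ A j ω then (1:ℝ) else 0)
        ≤ r + n * B := by
      intro i _
      rw [Finset.sum_comm]
      have : ∀ j ∈ (Finset.univ : Finset (Fin n)), ∑ ω, w ω * (if A i ω ∧ A j ω then (1:ℝ) else 0)
        ≤ (if j = i then r else 0) + B := by
        intro j _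
        by_cases h : j = i
        · subst h
          simp only [and_self, h1, if_true]
          linarith
        · simp only [h, if_false, zero_add]
          exact h2 i j (fun h' => h h'.symm)
      refine (Finset.sum_le_sum this).trans ?_
      rw [Finset.sum_add_distrib]
      simp
    refine (Finset.sum_le_sum this).trans ?_
    simp only [Finset.sum_const, Finset.card_univ, Fintype.card_fin, nsmul_eq_mul]
    apply le_of_eq
    rw [hm]; ring
  have key : (∑ ω, w ω * (if ∀ i, ¬ A i ω then 1 else 0)) * m ^ 2 ≤ m + n ^ 2 * B - m ^ 2 := by
    have : (∑ ω, w ω * (if ∀ i, ¬ A i ω then 1 else 0)) * m ^ 2 ≤ ∑ ω, w ω * (I ω - m) ^ 2 := by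
      rw [Finset.sum_mul]
      apply Finset.sum_le_sum
      intro ω _
      rw [mul_assoc]
      apply mul_le_mul_of_nonneg_left _ (hw ω)
      split_ifs with h
      · have : I ω = 0 := by simp [hI, h]
        rw [this]; nlinarith
      · nlinarith [sq_nonneg (I ω - m)]
    refine this.trans ?_
    have e : ∑ ω, w ω * (I ω - m) ^ 2 =
        ∑ ω, w ω * (I ω) ^ 2 - 2 * m * ∑ ω, w ω * I ω + m ^ 2 * ∑ ω, w ω := by
      rw [Finset.mul_sum, Finset.mul_sum, ← Finset.sum_sub_distrib, ← Finset.sum_add_distrib]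
      apply Finset.sum_congr rfl
      intro ω _
      ring
    rw [e, hEI, hw1]
    nlinarith
  have e : 1 / (n * r) + B / r ^ 2 - 1 = (m + n ^ 2 * B - m ^ 2) / m ^ 2 := by
    rw [hm]; field_simp
  rw [e, le_div_iff₀ (by positivity)]
  exact key

/-- The conditional non-adjacency probability given key rings. -/
def gf {P K : ℕ} (α : ℝ) (a x : KeyRing P K) : ℝ := if (a.1 ∩ x.1).Nonempty then 1 - α else 1

lemma sum_ind {P K : ℕ} (hKP : K < P) (a : KeyRing P K) :
    ∑ x : KeyRing P K, (if ¬ (a.1 ∩ x.1).Nonempty then (1:ℝ) else 0) = numKR P K * q K P := by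
  have hN : (P.choose K : ℝ) ≠ 0 := by
    exact_mod_cast (Nat.choose_pos hKP.le).ne'
  rw [Finset.sum_boole, card_disj, a.2, q_eq, numKR]
  field_simp

lemma gf_eq {P K : ℕ} (α : ℝ) (a x : KeyRing P K) :
    gf α a x = (1 - α) + α * (if ¬ (a.1 ∩ x.1).Nonempty then (1:ℝ) else 0) := by
  unfold gf
  by_cases h : (a.1 ∩ x.1).Nonempty <;> simp [h]

lemma sum_gf {P K : ℕ} (hKP : K < P) (α : ℝ) (a : KeyRing P K) :
    ∑ x, gf α a x = numKR P K * (1 - α * (1 - q K P)) := by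
  simp_rw [gf_eq]
  rw [Finset.sum_add_distrib, ← Finset.mul_sum, sum_ind hKP]
  rw [Finset.sum_const, Finset.card_univ, card_KR, nsmul_eq_mul, ← numKR]
  ring

lemma sum_gf_mul {P K : ℕ} (hKP : K < P) (α : ℝ) (a c : KeyRing P K) :
    ∑ x, gf α a x * gf α c x = numKR P K * ((1 - α) ^ 2 + 2 * α * (1 - α) * q K P) +
      α ^ 2 * ((P - (a.1 ∪ c.1).card).choose K : ℝ) := by
  rw [← card_disj, ← Finset.sum_boole]
  have e : ∀ x : KeyRing P K, gf α a x * gf α c x = (1 - α) ^ 2 +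
      α * (1 - α) * (if ¬ (a.1 ∩ x.1).Nonempty then (1:ℝ) else 0) +
      α * (1 - α) * (if ¬ (c.1 ∩ x.1).Nonempty then (1:ℝ) else 0) +
      α ^ 2 * (if ¬ ((a.1 ∪ c.1) ∩ x.1).Nonempty then (1:ℝ) else 0) := by
    intro x
    rw [gf_eq, gf_eq]
    simp only [Finset.union_inter_distrib_right, Finset.union_nonempty]
    by_cases h : (a.1 ∩ x.1).Nonempty <;> by_cases h' : (c.1 ∩ x.1).Nonempty <;>
      simp [h, h'] <;> ring
  simp_rw [e]
  rw [Finset.sum_add_distrib, Finset.sum_add_distrib, Finset.sum_add_distrib,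
    ← Finset.mul_sum, ← Finset.mul_sum, ← Finset.mul_sum, sum_ind hKP, sum_ind hKP]
  rw [Finset.sum_const, Finset.card_univ, card_KR, nsmul_eq_mul, ← numKR]
  ring

lemma numKR_pos {P K : ℕ} (hKP : K < P) : 0 < numKR P K := by
  unfold numKR
  exact_mod_cast (Nat.choose_pos hKP.le)

lemma numKR_mul_q {P K : ℕ} (hKP : K < P) : numKR P K * q K P = ((P - K).choose K : ℝ) := by
  have hN := numKR_pos hKP
  unfold numKR at hN ⊢
  rw [q_eq]; field_simp

lemma touchSet_mono {n : ℕ} (i : Fin n) (Q Q' : Fin n → Prop) [DecidablePred Q]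
    [DecidablePred Q'] (h : ∀ k, Q k → Q' k) : touchSet i Q ⊆ touchSet i Q' := by
  intro e he
  simp only [touchSet, Finset.mem_filter, Finset.mem_univ, true_and] at he ⊢
  rcases he with ⟨h1, h2⟩ | ⟨h1, h2⟩
  · exact Or.inl ⟨h1, h _ h2⟩
  · exact Or.inr ⟨h1, h _ h2⟩

lemma sum_gf_mul_disj {P K : ℕ} (hKP : K < P) (α : ℝ) (a c : KeyRing P K)
    (h : ¬ (a.1 ∩ c.1).Nonempty) :
    ∑ x, gf α a x * gf α c x ≤ numKR P K * ((1 - α * (1 - q K P)) ^ 2) := by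
  rw [sum_gf_mul hKP]
  have hd : Disjoint a.1 c.1 := by
    rw [Finset.disjoint_iff_inter_eq_empty]
    exact Finset.not_nonempty_iff_eq_empty.1 h
  rw [Finset.card_union_of_disjoint hd, a.2, c.2, ← two_mul]
  have hN := numKR_pos hKP
  have hl : ((P - 2 * K).choose K : ℝ) * numKR P K ≤ (numKR P K * q K P) ^ 2 := by
    have := choose_logconcave P K
    have e : numKR P K * q K P = ((P - K).choose K : ℝ) := by
      rw [numKR_mul_q hKP]
    rw [e, numKR]
    exact_mod_cast this
  have hl' : ((P - 2 * K).choose K : ℝ) ≤ numKR P K * q K P ^ 2 := by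
    have : ((P - 2 * K).choose K : ℝ) * numKR P K ≤ (numKR P K * q K P ^ 2) * numKR P K := by
      linarith
    exact le_of_mul_le_mul_right this hN
  nlinarith [mul_le_mul_of_nonneg_left hl' (sq_nonneg α)]

lemma sum_gf_mul_le {P K : ℕ} (hKP : K < P) (α : ℝ) (a c : KeyRing P K) :
    ∑ x, gf α a x * gf α c x ≤ numKR P K *
      (1 - 2 * (α * (1 - q K P)) + α * (α * (1 - q K P))) := by
  rw [sum_gf_mul hKP]
  have hN := numKR_pos hKP
  have e : numKR P K * q K P = ((P - K).choose K : ℝ) := by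
    rw [numKR_mul_q hKP]
  have hc : K ≤ (a.1 ∪ c.1).card := by
    have := Finset.card_le_card (Finset.subset_union_left (s₁ := a.1) (s₂ := c.1))
    rwa [a.2] at this
  have hl : ((P - (a.1 ∪ c.1).card).choose K : ℝ) ≤ numKR P K * q K P := by
    rw [e]
    exact_mod_cast Nat.choose_le_choose K (by omega)
  nlinarith [mul_le_mul_of_nonneg_left hl (sq_nonneg α)]

lemma q_nonneg (K P : ℕ) : 0 ≤ q K P := by rw [q_eq]; positivity

lemma q_le_one {K P : ℕ} (hKP : K < P) : q K P ≤ 1 := by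
  have hN := numKR_pos hKP
  unfold numKR at hN
  rw [q_eq, div_le_one hN]
  exact_mod_cast Nat.choose_le_choose K (by omega)

/-- sum over all link configurations -/
lemma sum_wt_off {n P K : ℕ} (α : ℝ) (κ : Fin n → KeyRing P K) (T : Finset (Pairs n)) :
    ∑ b : Pairs n → Bool, wt n P K α κ b * (if ∀ e ∈ T, b e = false then (1:ℝ) else 0) =
      (numKR P K)⁻¹ ^ n * (1 - α) ^ T.card := by
  rw [← sum_off, Finset.mul_sum]
  apply Finset.sum_congr rfl
  intro b _
  rw [wt, mul_assoc]

lemma isolated_iff {n P K : ℕ} (κ : Fin n → KeyRing P K) (b : Pairs n → Bool) (i : Fin n) :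
    Isolated κ b i ↔
      ∀ e ∈ touchSet i (fun k => k ≠ i ∧ ((κ i).1 ∩ (κ k).1).Nonempty), b e = false := by
  rw [link_false_iff]
  constructor
  · intro h k hk hq
    have := h k
    by_contra hc
    exact this ⟨hk.symm, hq.2, by simpa using hc⟩
  · rintro h k ⟨h1, h2, h3⟩
    have := h k h1.symm ⟨h1.symm, h2⟩
    rw [this] at h3
    cases h3

lemma prob1 {n P K : ℕ} (hn : 1 ≤ n) (hKP : K < P) (α : ℝ) (i : Fin n) :
    ∑ κ : Fin n → KeyRing P K, ∑ b : Pairs n → Bool,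
      wt n P K α κ b * (if Isolated κ b i then (1:ℝ) else 0) =
      (1 - α * (1 - q K P)) ^ (n - 1) := by
  have hN := numKR_pos hKP
  have h1 : ∀ κ : Fin n → KeyRing P K, ∑ b : Pairs n → Bool,
      wt n P K α κ b * (if Isolated κ b i then (1:ℝ) else 0) =
      (numKR P K)⁻¹ ^ n * ∏ k, (if k ≠ i then gf α (κ i) (κ k) else 1) := by
    intro κ
    simp_rw [isolated_iff]
    rw [sum_wt_off, touchSet_card _ _ (by simp), pow_card_filter]
    congr 1
    apply Finset.prod_congr rfl
    intro k _
    unfold gf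
    by_cases h : k = i <;> simp [h]
  simp_rw [h1]
  rw [← Finset.mul_sum, sum_split1 i (gf α)]
  simp_rw [sum_gf hKP]
  rw [Finset.sum_const, Finset.card_univ, card_KR, nsmul_eq_mul, ← numKR]
  obtain ⟨m, rfl⟩ := Nat.exists_eq_add_of_le hn
  have : 1 + m - 1 = m := by omega
  rw [this, mul_pow, pow_add, inv_pow, inv_pow]
  field_simp

lemma prob2 {n P K : ℕ} (hn : 2 ≤ n) (hKP : K < P) (α : ℝ) (h0 : 0 ≤ α) (h1 : α ≤ 1)
    (i j : Fin n) (hij : i ≠ j) :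
    ∑ κ : Fin n → KeyRing P K, ∑ b : Pairs n → Bool,
      wt n P K α κ b * (if Isolated κ b i ∧ Isolated κ b j then (1:ℝ) else 0) ≤
      q K P * ((1 - α * (1 - q K P)) ^ 2) ^ (n - 2) +
      (1 - q K P) * (1 - 2 * (α * (1 - q K P)) + α * (α * (1 - q K P))) ^ (n - 2) := by
  have hN := numKR_pos hKP
  have hwt : ∀ (κ : Fin n → KeyRing P K) (b : Pairs n → Bool), 0 ≤ wt n P K α κ b := by
    intro κ b
    unfold wt
    apply mul_nonneg (by positivity)
    apply Finset.prod_nonneg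
    intro e _
    split_ifs <;> linarith
  have step1 : ∀ κ : Fin n → KeyRing P K, ∑ b : Pairs n → Bool,
      wt n P K α κ b * (if Isolated κ b i ∧ Isolated κ b j then (1:ℝ) else 0) ≤
      (numKR P K)⁻¹ ^ n * ∏ k, (if k ≠ i ∧ k ≠ j then gf α (κ i) (κ k) * gf α (κ j) (κ k) else 1) := by
    intro κ
    set Ti := touchSet i (fun k => (k ≠ i ∧ k ≠ j) ∧ ((κ i).1 ∩ (κ k).1).Nonempty) with hTi
    set Tj := touchSet j (fun k => (k ≠ i ∧ k ≠ j) ∧ ((κ j).1 ∩ (κ k).1).Nonempty) with hTj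
    have hdisj : Disjoint Ti Tj := by
      rw [Finset.disjoint_left]
      rintro ⟨⟨x, y⟩, hxy⟩ ha hb
      simp only [hTi, hTj, touchSet, Finset.mem_filter, Finset.mem_univ, true_and] at ha hb
      grind
    have hle : ∑ b : Pairs n → Bool,
      wt n P K α κ b * (if Isolated κ b i ∧ Isolated κ b j then (1:ℝ) else 0) ≤
      ∑ b : Pairs n → Bool,
      wt n P K α κ b * (if ∀ e ∈ Ti ∪ Tj, b e = false then (1:ℝ) else 0) := by
      apply Finset.sum_le_sum
      intro b _
      apply mul_le_mul_of_nonneg_left _ (hwt κ b)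
      by_cases h : Isolated κ b i ∧ Isolated κ b j
      · rw [if_pos h, if_pos]
        rw [isolated_iff, isolated_iff] at h
        intro e he
        rcases Finset.mem_union.1 he with he | he
        · exact h.1 e (touchSet_mono i _ _ (fun k hk => ⟨hk.1.1, hk.2⟩) he)
        · exact h.2 e (touchSet_mono j _ _ (fun k hk => ⟨hk.1.2, hk.2⟩) he)
      · rw [if_neg h]
        split_ifs <;> norm_num
    refine hle.trans (le_of_eq ?_)
    rw [sum_wt_off, Finset.card_union_of_disjoint hdisj, pow_add, hTi, hTj,
      touchSet_card _ _ (by simp), touchSet_card _ _ (by simp), pow_card_filter, pow_card_filter,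
      ← Finset.prod_mul_distrib]
    congr 1
    apply Finset.prod_congr rfl
    intro k _
    unfold gf
    by_cases h : k ≠ i ∧ k ≠ j
    · simp [h]
    · simp only [h, false_and, if_false, mul_one]
  refine (Finset.sum_le_sum (fun κ _ => step1 κ)).trans ?_
  rw [← Finset.mul_sum, sum_split2 i j hij (fun a c x => gf α a x * gf α c x)]
  have hg0 : ∀ a x : KeyRing P K, 0 ≤ gf α a x := by
    intro a x
    unfold gf
    split_ifs <;> linarith
  set D := (1 - α * (1 - q K P)) ^ 2 with hD
  set R := 1 - 2 * (α * (1 - q K P)) + α * (α * (1 - q K P)) with hR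
  have hb : ∀ a c : KeyRing P K, (∑ x, gf α a x * gf α c x) ^ (n - 2) ≤
      (numKR P K * R) ^ (n - 2) + ((numKR P K * D) ^ (n - 2) - (numKR P K * R) ^ (n - 2)) *
        (if ¬ (a.1 ∩ c.1).Nonempty then (1:ℝ) else 0) := by
    intro a c
    have h0 : 0 ≤ ∑ x, gf α a x * gf α c x :=
      Finset.sum_nonneg (fun x _ => mul_nonneg (hg0 _ _) (hg0 _ _))
    by_cases h : (a.1 ∩ c.1).Nonempty
    · simp only [h, not_true_eq_false, if_false, mul_zero, add_zero]
      exact pow_le_pow_left₀ h0 (sum_gf_mul_le hKP α a c) _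
    · simp only [h, not_false_eq_true, if_true, mul_one, add_sub_cancel]
      exact pow_le_pow_left₀ h0 (sum_gf_mul_disj hKP α a c h) _
  have hs : ∑ a : KeyRing P K, ∑ c : KeyRing P K, (∑ x, gf α a x * gf α c x) ^ (n - 2) ≤
      numKR P K * (numKR P K * (numKR P K * R) ^ (n - 2) +
        ((numKR P K * D) ^ (n - 2) - (numKR P K * R) ^ (n - 2)) * (numKR P K * q K P)) := by
    refine (Finset.sum_le_sum (fun a _ => Finset.sum_le_sum (fun c _ => hb a c))).trans ?_
    simp_rw [Finset.sum_add_distrib, ← Finset.mul_sum, sum_ind hKP]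
    have hNK : (P.choose K : ℝ) = numKR P K := rfl
    simp only [Finset.sum_const, Finset.card_univ, card_KR, nsmul_eq_mul, hNK]
    apply le_of_eq
    ring
  refine (mul_le_mul_of_nonneg_left hs (by positivity)).trans (le_of_eq ?_)
  obtain ⟨m, rfl⟩ := Nat.exists_eq_add_of_le hn
  have : 2 + m - 2 = m := by omega
  rw [this, mul_pow, mul_pow, pow_add, inv_pow, inv_pow]
  field_simp
  ring

lemma wt_nonneg {n P K : ℕ} (α : ℝ) (h0 : 0 ≤ α) (h1 : α ≤ 1) (κ : Fin n → KeyRing P K)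
    (b : Pairs n → Bool) (hKP : K < P) : 0 ≤ wt n P K α κ b := by
  have hN := numKR_pos hKP
  unfold wt
  apply mul_nonneg (by positivity)
  apply Finset.prod_nonneg
  intro e _
  split_ifs <;> linarith

lemma prob_nonneg {n P K : ℕ} (hKP : K < P) (α : ℝ) (h0 : 0 ≤ α) (h1 : α ≤ 1) :
    0 ≤ probNoIsolated n P K α := by
  unfold probNoIsolated
  apply Finset.sum_nonneg; intro κ _
  apply Finset.sum_nonneg; intro b _
  apply mul_nonneg (wt_nonneg α h0 h1 κ b hKP)
  split_ifs <;> norm_num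

lemma prob_bound {n P K : ℕ} (hn : 2 ≤ n) (hKP : K < P) (α : ℝ) (h0 : 0 ≤ α) (h1 : α ≤ 1)
    (hp : α * (1 - q K P) < 1) :
    probNoIsolated n P K α ≤ 1 / (n * (1 - α * (1 - q K P)) ^ (n - 1)) +
      (q K P * ((1 - α * (1 - q K P)) ^ 2) ^ (n - 2) +
      (1 - q K P) * (1 - 2 * (α * (1 - q K P)) + α * (α * (1 - q K P))) ^ (n - 2)) /
      ((1 - α * (1 - q K P)) ^ (n - 1)) ^ 2 - 1 := by
  have hq0 := q_nonneg K P
  have hq1 := q_le_one hKP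
  have hN := numKR_pos hKP
  have hR : 0 ≤ 1 - 2 * (α * (1 - q K P)) + α * (α * (1 - q K P)) := by
    nlinarith [mul_nonneg hq0 (mul_nonneg h0 (by linarith : 0 ≤ 2 - α)), sq_nonneg (1 - α)]
  have key := chebyshev_aux (Ω := (Fin n → KeyRing P K) × (Pairs n → Bool))
    (fun ω => wt n P K α ω.1 ω.2) (fun ω => wt_nonneg α h0 h1 _ _ hKP) ?_ n (by omega)
    (fun i ω => Isolated ω.1 ω.2 i) ((1 - α * (1 - q K P)) ^ (n - 1))
    (q K P * ((1 - α * (1 - q K P)) ^ 2) ^ (n - 2) +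
      (1 - q K P) * (1 - 2 * (α * (1 - q K P)) + α * (α * (1 - q K P))) ^ (n - 2))
    (pow_pos (by linarith) _) ?_ ?_ ?_
  · rw [Fintype.sum_prod_type] at key
    exact key
  · rw [Fintype.sum_prod_type]
    have : ∀ κ : Fin n → KeyRing P K, ∑ b : Pairs n → Bool, wt n P K α κ b =
        (numKR P K)⁻¹ ^ n := by
      intro κ
      have := sum_wt_off α κ ∅
      simpa using this
    simp only [this]
    rw [Finset.sum_const, Finset.card_univ, Fintype.card_fun, card_KR, nsmul_eq_mul,
      Fintype.card_fin, Nat.cast_pow, ← numKR, ← mul_pow, mul_inv_cancel₀ hN.ne', one_pow]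
  · have : 0 ≤ 1 - q K P := by linarith
    positivity
  · intro i
    rw [Fintype.sum_prod_type]
    exact prob1 (by omega) hKP α i
  · intro i j hij
    rw [Fintype.sum_prod_type]
    exact prob2 hn hKP α h0 h1 i j hij

/-- pure real bound -/
lemma real_bound (n : ℕ) (hn : 2 ≤ n) (α p Q γ ε : ℝ) (h0 : 0 ≤ α) (hQ1 : Q ≤ 1)
    (hp : α * (1 - Q) = p) (hp2 : p ≤ 1 / 2) (hnp : n * p = Real.log n + γ)
    (hL : n * p ≤ Real.log n)
    (hε : α * (1 / (1 - p) ^ 2) ≤ 1 - ε) :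
    1 / (n * (1 - p) ^ (n - 1)) + (Q * ((1 - p) ^ 2) ^ (n - 2) +
      (1 - Q) * (1 - 2 * p + α * p) ^ (n - 2)) / ((1 - p) ^ (n - 1)) ^ 2 - 1 ≤
    Real.exp (γ + 2 * (Real.log n ^ 2 / n)) + 
      (1 / (1 - p) ^ 2 * (1 + 4 * (Real.log n ^ 2 / (n:ℝ) ^ ε)) - 1) := by
  have hn0 : (0:ℝ) < n := by positivity
  have hp0 : 0 ≤ p := by rw [← hp]; exact mul_nonneg h0 (by linarith)
  have h1p : 0 < 1 - p := by linarith
  set L := Real.log n with hLdef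
  have hL0 : 0 ≤ L := by nlinarith
  have hnpp : n * p ^ 2 ≤ L ^ 2 / n := by
    rw [le_div_iff₀ hn0]
    nlinarith [mul_nonneg hn0.le hp0]
  have hexpL : Real.exp L = n := Real.exp_log hn0
  have t1 : 1 / (n * (1 - p) ^ (n - 1)) ≤ Real.exp (γ + 2 * (L ^ 2 / n)) := by
    have a1 : 1 / (1 - p) ≤ Real.exp (p + 2 * p ^ 2) := by
      have := Real.add_one_le_exp (p + 2 * p ^ 2)
      refine le_trans ?_ this
      rw [div_le_iff₀ h1p]
      nlinarith [mul_nonneg (sq_nonneg p) (by linarith : 0 ≤ 1 - 2 * p)]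
    have a2 : 1 / (1 - p) ^ (n - 1) ≤ Real.exp (n * (p + 2 * p ^ 2)) := by
      calc 1 / (1 - p) ^ (n - 1) = (1 / (1 - p)) ^ (n - 1) := by rw [one_div_pow]
        _ ≤ (1 / (1 - p)) ^ n := by
          apply pow_le_pow_right₀ _ (by omega)
          rw [le_div_iff₀ h1p]; linarith
        _ ≤ Real.exp (p + 2 * p ^ 2) ^ n := pow_le_pow_left₀ (by positivity) a1 _
        _ = _ := by rw [← Real.exp_nat_mul]
    calc 1 / (n * (1 - p) ^ (n - 1)) = 1 / (1 - p) ^ (n - 1) / n := by field_simp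
      _ ≤ Real.exp (n * (p + 2 * p ^ 2)) / n := by gcongr
      _ = Real.exp (n * (p + 2 * p ^ 2) - L) := by rw [Real.exp_sub, hexpL]
      _ ≤ _ := by
        apply Real.exp_le_exp.2
        nlinarith
  set D := 1 / (1 - p) ^ 2 with hD
  have hD0 : 0 < D := by positivity
  have hD4 : D ≤ 4 := by
    rw [hD, div_le_iff₀ (by positivity)]
    nlinarith
  have t2 : (Q * ((1 - p) ^ 2) ^ (n - 2) +
      (1 - Q) * (1 - 2 * p + α * p) ^ (n - 2)) / ((1 - p) ^ (n - 1)) ^ 2 =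
      D * (Q + (1 - Q) * ((1 - 2 * p + α * p) * D) ^ (n - 2)) := by
    obtain ⟨m, rfl⟩ := Nat.exists_eq_add_of_le hn
    have e1 : 2 + m - 2 = m := by omega
    have e2 : 2 + m - 1 = m + 1 := by omega
    rw [e1, e2, hD, mul_pow, ← pow_mul, ← pow_mul, one_div_pow, ← pow_mul]
    field_simp
    ring
  rw [t2]
  set x := n * (α * p * D) with hx
  have hx0 : 0 ≤ x := by positivity
  have hα2 : 0 ≤ (1 - 2 * p + α * p) * D := by
    apply mul_nonneg _ hD0.le
    nlinarith [mul_nonneg h0 hp0]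
  have t3 : ((1 - 2 * p + α * p) * D) ^ (n - 2) ≤ Real.exp x := by
    have a1 : (1 - 2 * p + α * p) * D ≤ Real.exp (α * p * D) := by
      refine le_trans ?_ (Real.add_one_le_exp _)
      have : (1 - p) ^ 2 * D = 1 := by rw [hD]; field_simp
      nlinarith [mul_nonneg (sq_nonneg p) hD0.le]
    calc ((1 - 2 * p + α * p) * D) ^ (n - 2) ≤ Real.exp (α * p * D) ^ (n - 2) :=
          pow_le_pow_left₀ hα2 a1 _
      _ ≤ Real.exp (α * p * D) ^ n := by
          apply pow_le_pow_right₀ _ (by omega)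
          exact Real.one_le_exp (by positivity)
      _ = _ := by rw [← Real.exp_nat_mul]
  have t4 : Real.exp x ≤ 1 + x * Real.exp x := by
    have := Real.add_one_le_exp (-x)
    have h2 : Real.exp (-x) * Real.exp x = 1 := by rw [← Real.exp_add]; simp
    nlinarith [Real.exp_pos x]
  have t5 : Real.exp x ≤ n / (n:ℝ) ^ ε := by
    have : x ≤ L - L * ε := by
      have : x = (α * D) * (n * p) := by rw [hx]; ring
      rw [this]
      have h3 : 0 ≤ n * p := by positivity
      have h4 : 0 ≤ α * D := by positivity
      nlinarith
    refine (Real.exp_le_exp.2 this).trans (le_of_eq ?_)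
    rw [Real.exp_sub, hexpL, Real.rpow_def_of_pos hn0]
  have t6 : (1 - Q) * x * Real.exp x ≤ 4 * (L ^ 2 / (n:ℝ) ^ ε) := by
    have e : (1 - Q) * x = n * p ^ 2 * D := by
      rw [hx, ← hp]; ring
    rw [e]
    calc n * p ^ 2 * D * Real.exp x ≤ (L ^ 2 / n) * 4 * (n / (n:ℝ) ^ ε) := by gcongr
      _ = _ := by field_simp
  have t7 : Q + (1 - Q) * ((1 - 2 * p + α * p) * D) ^ (n - 2) ≤ 1 + 4 * (L ^ 2 / (n:ℝ) ^ ε) := by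
    have := mul_le_mul_of_nonneg_left (t3.trans t4) (by linarith : 0 ≤ 1 - Q)
    nlinarith
  have t8 := mul_le_mul_of_nonneg_left t7 hD0.le
  linarith

lemma log_sq_div (ε : ℝ) (hε : 0 < ε) :
    Tendsto (fun n : ℕ => Real.log n ^ 2 / (n:ℝ) ^ ε) atTop (nhds 0) := by
  have h := (isLittleO_log_rpow_rpow_atTop 2 hε).tendsto_div_nhds_zero
  have h2 := h.comp tendsto_natCast_atTop_atTop
  refine h2.congr (fun n => ?_)
  simp

end Aux

/-- Theorem 2 (very strong zero-law for absence of isolated nodes):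
if `α_n (1 - q(θ_n)) = (log n + γ_n)/n` with `γ_n → -∞`, and either
(a) `limsup_n α_n log n < ∞` (i.e. the sequence is bounded above), or
(b) `limsup_n α_n log n = ∞` (i.e. not bounded above) and `limsup_n α_n < 1`,
then `P_n(θ_n, α_n) → 0`. -/
theorem veryStrongZeroLaw
    (K P : ℕ → ℕ) (α γ : ℕ → ℝ)
    (hK : ∀ n, 0 < K n) (hKP : ∀ n, K n < P n)
    (hα : ∀ n, 0 ≤ α n ∧ α n ≤ 1)
    (hscal : ∀ n, 1 ≤ n → α n * (1 - q (K n) (P n)) = (Real.log n + γ n) / n)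
    (hγ : Tendsto γ atTop atBot)
    (hcond :
      (IsBoundedUnder (· ≤ ·) atTop fun n => α n * Real.log n) ∨
      ((¬ IsBoundedUnder (· ≤ ·) atTop fun n => α n * Real.log n) ∧
        limsup (fun n => α n) atTop < 1)) :
    Tendsto (fun n => probNoIsolated n (P n) (K n) (α n)) atTop (nhds 0) := by
  have hp1 : ∀ n, 1 ≤ n → n * (α n * (1 - q (K n) (P n))) = Real.log n + γ n := by
    intro n hn
    rw [hscal n hn]
    have : (n:ℝ) ≠ 0 := by positivity
    field_simp
  have hp0 : ∀ n, 0 ≤ α n * (1 - q (K n) (P n)) := fun n =>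
    mul_nonneg (hα n).1 (by linarith [q_le_one (hKP n)])
  have hlog : Tendsto (fun n : ℕ => Real.log n) atTop atTop :=
    Real.tendsto_log_atTop.comp tendsto_natCast_atTop_atTop
  have hpL : ∀ᶠ n in atTop, n * (α n * (1 - q (K n) (P n))) ≤ Real.log n := by
    filter_upwards [hγ.eventually_le_atBot 0, eventually_ge_atTop 1] with n h1 h2
    rw [hp1 n h2]; linarith
  have hpt : Tendsto (fun n => α n * (1 - q (K n) (P n))) atTop (nhds 0) := by
    have hld : Tendsto (fun n : ℕ => Real.log n / (n:ℝ)) atTop (nhds 0) := by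
      have h := Real.isLittleO_log_id_atTop.tendsto_div_nhds_zero
      exact h.comp tendsto_natCast_atTop_atTop
    refine tendsto_of_tendsto_of_tendsto_of_le_of_le' tendsto_const_nhds hld
      (Eventually.of_forall hp0) ?_
    filter_upwards [hpL, eventually_ge_atTop 1] with n h1 h2
    have : (0:ℝ) < n := by positivity
    rw [le_div_iff₀ this]
    linarith
  obtain ⟨c, hc1, hc⟩ : ∃ c : ℝ, c < 1 ∧ ∀ᶠ n in atTop, α n ≤ c := by
    rcases hcond with ha | ⟨_, hb⟩
    · obtain ⟨M, hM⟩ := ha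
      rw [eventually_map] at hM
      refine ⟨1 / 2, by norm_num, ?_⟩
      filter_upwards [hM, hlog.eventually_ge_atTop (2 * M), hlog.eventually_ge_atTop 1]
        with n h1 h2 h3
      by_contra hcon
      push Not at hcon
      nlinarith
    · obtain ⟨c, h1, h2⟩ := exists_between hb
      refine ⟨c, h2, ?_⟩
      have hbdd : IsBoundedUnder (· ≤ ·) atTop (fun n => α n) :=
        isBoundedUnder_of ⟨1, fun n => (hα n).2⟩
      filter_upwards [eventually_lt_of_limsup_lt h1 hbdd] with n hn
      exact hn.le
  set ε : ℝ := (1 - c) / 2 with hε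
  have hεpos : 0 < ε := by rw [hε]; linarith
  have hDt : Tendsto (fun n => 1 / (1 - α n * (1 - q (K n) (P n))) ^ 2) atTop (nhds 1) := by
    have h := ((tendsto_const_nhds (x := (1:ℝ))).sub hpt).pow 2
    have h' := (tendsto_const_nhds (x := (1:ℝ))).div h (by norm_num)
    have e : (1:ℝ) / (1 - 0) ^ 2 = 1 := by norm_num
    rw [e] at h'
    exact h'
  have hcD : ∀ᶠ n in atTop, α n * (1 / (1 - α n * (1 - q (K n) (P n))) ^ 2) ≤ 1 - ε := by
    have h := hDt.const_mul c
    rw [mul_one] at h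
    have h2 : c < 1 - ε := by rw [hε]; linarith
    filter_upwards [h.eventually_lt_const h2, hc] with n h3 h4
    refine le_trans ?_ h3.le
    exact mul_le_mul_of_nonneg_right h4 (by positivity)
  have hupper : Tendsto (fun n : ℕ => Real.exp (γ n + 2 * (Real.log n ^ 2 / n)) +
      (1 / (1 - α n * (1 - q (K n) (P n))) ^ 2 * (1 + 4 * (Real.log n ^ 2 / (n:ℝ) ^ ε)) - 1))
      atTop (nhds 0) := by
    have e1 : Tendsto (fun n : ℕ => Real.exp (γ n + 2 * (Real.log n ^ 2 / n))) atTop (nhds 0) := by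
      apply Real.tendsto_exp_atBot.comp
      have h := (log_sq_div 1 one_pos).const_mul 2
      simp only [Real.rpow_one] at h
      exact hγ.atBot_add h
    have e2 := hDt.mul (((log_sq_div ε hεpos).const_mul 4).const_add 1)
    have e3 := e1.add (e2.sub_const 1)
    simpa using e3
  refine tendsto_of_tendsto_of_tendsto_of_le_of_le' tendsto_const_nhds hupper
    (Eventually.of_forall fun n => prob_nonneg (hKP n) _ (hα n).1 (hα n).2) ?_
  filter_upwards [hpL, hcD, hpt.eventually_lt_const (by norm_num : (0:ℝ) < 1 / 2),
    eventually_ge_atTop 2] with n h1 h2 h3 h4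
  refine (prob_bound h4 (hKP n) (α n) (hα n).1 (hα n).2 (by linarith)).trans ?_
  exact real_bound n h4 (α n) _ (q (K n) (P n)) (γ n) ε (hα n).1 (q_le_one (hKP n))
    rfl h3.le (hp1 n (by omega)) h1 h2
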